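/- arXiv:2506.17132 — 5 statements merged into one kernel-verified Lean document; each statement's English description precedes it below -/
import Mathlib

section
/- Let n ≥ 1. A complex number g belongs to the convex hull 𝒫_n of the n-th roots of unity if and only if there exists a positive semidefinite matrix G : Matrix (ZMod n) (ZMod n) ℂ which is circulant (G (i+k) (j+k) = G i j for all i, j, k), has unit diagonal (G i i = 1 for all i), and satisfies G 0 1 = g. -/
open scoped ComplexOrder

/-- Complex conjugation acts on the standard additive character by negating its argument. -/
theorem ZMod.star_stdAddChar {n : ℕ} [NeZero n] (x : ZMod n) :
    star (stdAddChar x : ℂ) = stdAddChar (-x) :=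
  (AddChar.map_neg_eq_conj _ _).symm

open ZMod in
/-- The powers of `exp (2πi / n)` are the values of the standard additive character. -/
theorem setOf_exp_pow_eq_range_stdAddChar (n : ℕ) [NeZero n] :
    {w : ℂ | ∃ k < n, w = Complex.exp (2 * Real.pi * Complex.I / n) ^ k} =
      Set.range (stdAddChar : ZMod n → ℂ) := by
  have natCast_apply (k : ℕ) :
      stdAddChar (k : ZMod n) = Complex.exp (2 * Real.pi * Complex.I / n) ^ k := by
    rw [stdAddChar_apply, toCircle_natCast, ← Complex.exp_nat_mul]
    congr 1
    ring
  ext w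
  constructor
  · rintro ⟨k, -, rfl⟩
    exact ⟨k, natCast_apply k⟩
  · rintro ⟨k, rfl⟩
    exact ⟨k.val, k.val_lt, by rw [← natCast_apply, natCast_zmod_val]⟩

/-- The entries at `(0, 1)` of normalized circulant positive semidefinite matrices form a
convex set. -/
theorem convex_setOf_circulant_gram_entry (n : ℕ) [NeZero n] :
    Convex ℝ {g : ℂ | ∃ G : Matrix (ZMod n) (ZMod n) ℂ,
      G.PosSemidef ∧
      (∀ i j k : ZMod n, G (i + k) (j + k) = G i j) ∧
      (∀ i, G i i = 1) ∧
      G 0 1 = g} := by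
  rintro _ ⟨G, hG, hGc, hGd, rfl⟩ _ ⟨H, hH, hHc, hHd, rfl⟩ a b ha hb hab
  refine ⟨a • G + b • H, (hG.smul ha).add (hH.smul hb), ?_, ?_, ?_⟩
  · intro i j k
    simp [hGc, hHc]
  · intro i
    simp only [Matrix.add_apply, Matrix.smul_apply, hGd, hHd]
    rw [← add_smul, hab, one_smul]
  · simp

open ZMod in
/-- Every value of the standard additive character is the entry at `(0, 1)` of a normalized
circulant positive semidefinite matrix (of rank one). -/
theorem exists_circulant_gram_entry_eq_stdAddChar {n : ℕ} [NeZero n] (k : ZMod n) :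
    ∃ G : Matrix (ZMod n) (ZMod n) ℂ,
      G.PosSemidef ∧
      (∀ i j k : ZMod n, G (i + k) (j + k) = G i j) ∧
      (∀ i, G i i = 1) ∧
      G 0 1 = stdAddChar k := by
  let v : ZMod n → ℂ := fun i ↦ stdAddChar (i * k)
  have entry (i j : ZMod n) :
      Matrix.vecMulVec (star v) v i j = stdAddChar ((j - i) * k) := by
    simp only [Matrix.vecMulVec_apply, Pi.star_apply, v, star_stdAddChar, ← AddChar.map_add_eq_mul]
    congr 1
    ring
  refine ⟨_, Matrix.posSemidef_vecMulVec_star_self v, ?_, ?_, ?_⟩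
  · intro i j l
    simp only [entry, add_sub_add_right_eq_sub]
  · intro i
    simp [entry]
  · simp [entry]

open ZMod in
/-- The discrete Fourier transform of the first row of a circulant positive semidefinite matrix
is nonnegative. -/
theorem Matrix.PosSemidef.dft_nonneg_of_circulant {n : ℕ} [NeZero n]
    {G : Matrix (ZMod n) (ZMod n) ℂ} (hG : G.PosSemidef)
    (hc : ∀ i j k : ZMod n, G (i + k) (j + k) = G i j) (k : ZMod n) :
    0 ≤ dft (G 0) k := by
  have quadratic_form := hG.dotProduct_mulVec_nonneg fun j ↦ stdAddChar (-(j * k))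
  have row_sum (i : ZMod n) :
      stdAddChar (i * k) * ∑ j, G i j * stdAddChar (-(j * k)) = dft (G 0) k := by
    rw [dft_apply, Finset.mul_sum, ← Equiv.sum_comp (Equiv.addRight i)]
    refine Finset.sum_congr rfl fun j _ ↦ ?_
    have shift := hc 0 j i
    rw [zero_add] at shift
    rw [Equiv.coe_addRight, shift, smul_eq_mul, mul_left_comm, ← AddChar.map_add_eq_mul,
      mul_comm (G 0 j)]
    congr 2
    ring
  simp only [dotProduct, Matrix.mulVec, Pi.star_apply, star_stdAddChar, neg_neg, row_sum,
    Finset.sum_const, Finset.card_univ, ZMod.card, nsmul_eq_mul] at quadratic_form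
  exact le_of_mul_le_mul_left (by simpa using quadratic_form)
    (Nat.cast_pos.mpr (NeZero.pos n) : (0 : ℂ) < n)

/-- A complex number belongs to the convex hull of the `n`-th roots of unity iff it is
the `(0,1)` entry of a positive semidefinite circulant matrix with unit diagonal. -/
theorem mem_polygon_iff_circulant_gram_entry
    (n : ℕ) [NeZero n] (g : ℂ) :
    g ∈ convexHull ℝ
        {w : ℂ | ∃ k < n, w = Complex.exp (2 * Real.pi * Complex.I / n) ^ k} ↔
    ∃ G : Matrix (ZMod n) (ZMod n) ℂ,
      G.PosSemidef ∧
      (∀ i j k : ZMod n, G (i + k) (j + k) = G i j) ∧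
      (∀ i, G i i = 1) ∧
      G 0 1 = g := by
  rw [setOf_exp_pow_eq_range_stdAddChar]
  constructor
  · intro hg
    refine convexHull_min ?_ (convex_setOf_circulant_gram_entry n) hg
    rintro _ ⟨k, rfl⟩
    exact exists_circulant_gram_entry_eq_stdAddChar k
  · rintro ⟨G, hG, hc, hd, rfl⟩
    have inversion (j : ZMod n) :
        ∑ k, (n : ℂ)⁻¹ * ZMod.dft (G 0) k * ZMod.stdAddChar (k * j) = G 0 j := by
      conv_rhs => rw [← ZMod.dft.symm_apply_apply (G 0), ZMod.invDFT_apply, smul_eq_mul,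
        Finset.mul_sum]
      refine Finset.sum_congr rfl fun k _ ↦ ?_
      rw [smul_eq_mul]
      ring
    choose w hw hwG using fun k ↦ RCLike.nonneg_iff_exists_ofReal.mp
      (mul_nonneg (inv_nonneg.mpr (Nat.cast_nonneg (α := ℂ) n)) (hG.dft_nonneg_of_circulant hc k))
    have sum_weights : ∑ k, w k = 1 := by
      have h := inversion 0
      simp only [← hwG, mul_zero, AddChar.map_zero_eq_one, mul_one, hd] at h
      exact Complex.ofReal_injective (by simpa using h)
    have combination := (convex_convexHull ℝ (Set.range (ZMod.stdAddChar : ZMod n → ℂ))).sum_mem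
      (fun k _ ↦ hw k) sum_weights fun k _ ↦ subset_convexHull ℝ _ ⟨k, rfl⟩
    have entry := inversion 1
    simp only [← hwG, mul_one] at entry
    rw [← entry]
    simpa using combination
end

section
/- For every n ≥ 1, the set 𝒫_n^n = {z^n : z ∈ 𝒫_n} ⊆ ℂ is convex, where 𝒫_n is the convex hull of the n-th roots of unity. -/
/-- The tangent-line inequality for the curve `t ↦ (1 + t * I) ^ (m + 1)`, in polar form. -/
lemma cos_add_mul_mul_cos_pow_le (m : ℕ) (a δ : ℝ) (ha : 0 ≤ Real.cos a)
    (hb : 0 ≤ Real.cos (a + δ)) (hδ : m * |δ| ≤ Real.pi) :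
    Real.cos (a + (m + 1) * δ) * Real.cos a ^ m ≤ Real.cos (a + δ) ^ (m + 1) := by
  induction m with
  | zero => simp
  | succ m ih =>
    push_cast at hδ ⊢
    have hδ0 := abs_nonneg δ
    have ih' := ih (by nlinarith)
    have hsin : 0 ≤ Real.sin ((m + 1) * δ) * Real.sin δ := by
      have hle : |δ| ≤ Real.pi := by
        have : (0 : ℝ) ≤ m * |δ| := by positivity
        nlinarith
      have key : 0 ≤ Real.sin ((m + 1) * |δ|) * Real.sin |δ| :=
        mul_nonneg (Real.sin_nonneg_of_nonneg_of_le_pi (by positivity) hδ)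
          (Real.sin_nonneg_of_nonneg_of_le_pi hδ0 hle)
      rcases abs_choice δ with h | h <;> rw [h] at key
      · exact key
      · simpa [Real.sin_neg] using key
    have hstep : Real.cos (a + (m + 1 + 1) * δ) * Real.cos a
        ≤ Real.cos (a + (m + 1) * δ) * Real.cos (a + δ) := by
      have e1 : a + (m + 1 + 1) * δ = (a + (m + 1) * δ) + δ := by ring
      rw [e1, Real.cos_add _ δ, Real.cos_add a δ, Real.cos_add a, Real.sin_add a]
      nlinarith [Real.sin_sq_add_cos_sq a]
    calc Real.cos (a + (m + 1 + 1) * δ) * Real.cos a ^ (m + 1)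
        = (Real.cos (a + (m + 1 + 1) * δ) * Real.cos a) * Real.cos a ^ m := by ring
      _ ≤ (Real.cos (a + (m + 1) * δ) * Real.cos (a + δ)) * Real.cos a ^ m := by gcongr
      _ = (Real.cos (a + (m + 1) * δ) * Real.cos a ^ m) * Real.cos (a + δ) := by ring
      _ ≤ Real.cos (a + δ) ^ (m + 1) * Real.cos (a + δ) := by gcongr
      _ = Real.cos (a + δ) ^ (m + 1 + 1) := by ring

lemma cos_mul_sub_mul_cos_pow_le_of_le (m : ℕ) (hm : 1 ≤ m) {a b : ℝ} (hab : a ≤ b)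
    (ha : |a| ≤ Real.pi / (m + 1)) (hb : |b| ≤ Real.pi / (m + 1)) :
    Real.cos ((m + 1) * b - m * a) * Real.cos a ^ m ≤ Real.cos b ^ (m + 1) := by
  have hm' : (1 : ℝ) ≤ m := by exact_mod_cast hm
  have hpi := Real.pi_pos
  set q := Real.pi / (m + 1) with hq
  have hqm : q * (m + 1) = Real.pi := by rw [hq]; field_simp
  have hq0 : 0 < q := by positivity
  have hq2 : q ≤ Real.pi / 2 := by nlinarith
  rw [abs_le] at ha hb
  have hca : 0 ≤ Real.cos a := Real.cos_nonneg_of_neg_pi_div_two_le_of_le (by linarith) (by linarith)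
  have hcb : 0 ≤ Real.cos b := Real.cos_nonneg_of_neg_pi_div_two_le_of_le (by linarith) (by linarith)
  by_cases h : m * (b - a) ≤ Real.pi
  · have := cos_add_mul_mul_cos_pow_le m a (b - a) hca (by simpa using hcb)
      (by rwa [abs_of_nonneg (by linarith)])
    convert this using 3 <;> ring_nf
  · push Not at h
    have hb' : -(Real.pi / 2) ≤ b - 2 * q := by
      by_contra! hcon
      rcases hm.eq_or_lt with h1 | h1
      · have : (m : ℝ) = 1 := by exact_mod_cast h1.symm
        rw [this] at h hqm
        linarith
      · have : (2 : ℝ) ≤ m := by exact_mod_cast h1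
        nlinarith
    have hcb' : 0 ≤ Real.cos (b - 2 * q) :=
      Real.cos_nonneg_of_neg_pi_div_two_le_of_le hb' (by linarith)
    have := cos_add_mul_mul_cos_pow_le m a (b - 2 * q - a) hca (by simpa using hcb') (by
      rw [abs_of_nonpos (by linarith)]
      nlinarith)
    have e : a + (m + 1) * (b - 2 * q - a) = (m + 1) * b - m * a - 2 * Real.pi := by
      rw [← hqm]; ring
    rw [e, Real.cos_sub_two_pi, add_sub_cancel] at this
    refine this.trans (pow_le_pow_left₀ hcb' ?_ _)
    rw [← Real.cos_abs b, ← Real.cos_neg (b - 2 * q)]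
    apply Real.cos_le_cos_of_nonneg_of_le_pi (abs_nonneg _) (by linarith)
    rw [abs_le]
    constructor <;> linarith

lemma cos_mul_sub_mul_cos_pow_le (m : ℕ) (hm : 1 ≤ m) {a b : ℝ}
    (ha : |a| ≤ Real.pi / (m + 1)) (hb : |b| ≤ Real.pi / (m + 1)) :
    Real.cos ((m + 1) * b - m * a) * Real.cos a ^ m ≤ Real.cos b ^ (m + 1) := by
  rcases le_total a b with h | h
  · exact cos_mul_sub_mul_cos_pow_le_of_le m hm h ha hb
  · have := cos_mul_sub_mul_cos_pow_le_of_le m hm (neg_le_neg h) (by rwa [abs_neg])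
      (by rwa [abs_neg])
    rw [Real.cos_neg, Real.cos_neg, ← Real.cos_neg (_ - _)] at this
    convert this using 3
    ring

lemma cos_odd_mul_pi_div_le (n : ℕ) (hn : 1 ≤ n) (j : ℤ) (hj : Odd j) :
    Real.cos (j * (Real.pi / n)) ≤ Real.cos (Real.pi / n) := by
  have hn' : (1 : ℝ) ≤ n := by exact_mod_cast hn
  have hpi := Real.pi_pos
  set q := Real.pi / n with hq
  have hqn : n * q = Real.pi := by rw [hq]; field_simp
  have hq0 : 0 < q := by positivity
  obtain ⟨l, hl⟩ := hj
  have hs := Int.emod_add_mul_ediv j (2 * n)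
  have hs0 := Int.emod_nonneg j (b := 2 * n) (by omega)
  have hs1 := Int.emod_lt_of_pos j (b := 2 * n) (by omega)
  set s := j % (2 * n)
  set t := j / (2 * n)
  have hs2 : 1 ≤ s := by
    rcases hs0.eq_or_lt with h | h
    · rw [← h, mul_assoc] at hs
      omega
    · omega
  have hcos : Real.cos (j * q) = Real.cos (s * q) := by
    have : (j : ℝ) * q = s * q + t * (2 * Real.pi) := by
      rw [← hqn, ← hs]; push_cast; ring
    rw [this, Real.cos_add_int_mul_two_pi]
  have hs2' : (1 : ℝ) ≤ s := by exact_mod_cast hs2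
  rw [hcos]
  rcases le_total s n with h | h
  · have h' : (s : ℝ) ≤ n := by exact_mod_cast h
    exact Real.cos_le_cos_of_nonneg_of_le_pi hq0.le (by nlinarith) (by nlinarith)
  · have h' : (n : ℝ) ≤ s := by exact_mod_cast h
    have h3 : (s : ℝ) + 1 ≤ 2 * n := by exact_mod_cast hs1
    rw [← Real.cos_two_pi_sub]
    exact Real.cos_le_cos_of_nonneg_of_le_pi hq0.le (by nlinarith) (by nlinarith)

lemma exp_two_pi_mul_I_div_pow (n k : ℕ) :
    Complex.exp (2 * Real.pi * Complex.I / n) ^ k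
      = Complex.exp (((2 * k * (Real.pi / n) : ℝ) : ℂ) * Complex.I) := by
  rw [← Complex.exp_nat_mul]
  congr 1
  push_cast
  ring

/-- The regular `n`-gon lies on the inner side of each of its edges. -/
lemma re_mul_cos_add_im_mul_sin_le_of_mem_polygon (n : ℕ) (hn : 1 ≤ n) (j : ℤ) (hj : Odd j)
    {z : ℂ} (hz : z ∈ convexHull ℝ
      {w : ℂ | ∃ k < n, w = Complex.exp (2 * Real.pi * Complex.I / n) ^ k}) :
    z.re * Real.cos (j * (Real.pi / n)) + z.im * Real.sin (j * (Real.pi / n))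
      ≤ Real.cos (Real.pi / n) := by
  have hconv : Convex ℝ {z : ℂ | z.re * Real.cos (j * (Real.pi / n))
      + z.im * Real.sin (j * (Real.pi / n)) ≤ Real.cos (Real.pi / n)} := by
    intro x hx y hy s t hs ht hst
    simp only [Set.mem_ofPred_eq, Complex.add_re, Complex.add_im, Complex.real_smul,
      Complex.re_ofReal_mul, Complex.im_ofReal_mul] at *
    obtain rfl : t = 1 - s := by linarith
    nlinarith
  refine convexHull_min ?_ hconv hz
  rintro _ ⟨k, -, rfl⟩
  rw [Set.mem_ofPred_eq, exp_two_pi_mul_I_div_pow, Complex.exp_ofReal_mul_I_re,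
    Complex.exp_ofReal_mul_I_im, ← Real.cos_sub]
  have := cos_odd_mul_pi_div_le n hn (2 * k - j) (by
    obtain ⟨l, rfl⟩ := hj
    exact ⟨k - l - 1, by ring⟩)
  convert this using 2
  push_cast
  ring

lemma zero_mem_polygon (n : ℕ) (hn : 2 ≤ n) :
    (0 : ℂ) ∈ convexHull ℝ
      {w : ℂ | ∃ k < n, w = Complex.exp (2 * Real.pi * Complex.I / n) ^ k} := by
  have hprim := Complex.isPrimitiveRoot_exp n (by omega)
  have hsum := hprim.geom_sum_eq_zero (by omega)
  have hn0 : (n : ℝ) ≠ 0 := by positivity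
  have := (convex_convexHull ℝ {w : ℂ | ∃ k < n,
      w = Complex.exp (2 * Real.pi * Complex.I / n) ^ k}).sum_mem (t := Finset.range n)
    (w := fun _ => (n : ℝ)⁻¹)
    (z := fun k => Complex.exp (2 * Real.pi * Complex.I / n) ^ k)
    (fun _ _ => by positivity) (by simp [hn0])
    (fun k hk => subset_convexHull ℝ _ ⟨k, Finset.mem_range.1 hk, rfl⟩)
  rwa [← Finset.smul_sum, hsum, smul_zero] at this

/-- Polar description of the sector of the regular `n`-gon spanned by its first edge. -/
lemma mul_exp_mem_polygon (n : ℕ) (hn : 3 ≤ n) {r φ : ℝ} (hr : 0 ≤ r)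
    (hφ : |φ| ≤ Real.pi / n) (h : r * Real.cos φ ≤ Real.cos (Real.pi / n)) :
    (r : ℂ) * Complex.exp (((φ + Real.pi / n : ℝ) : ℂ) * Complex.I) ∈ convexHull ℝ
      {w : ℂ | ∃ k < n, w = Complex.exp (2 * Real.pi * Complex.I / n) ^ k} := by
  have hn' : (3 : ℝ) ≤ n := by exact_mod_cast hn
  have hpi := Real.pi_pos
  have h0 := zero_mem_polygon n (by omega)
  have h1 : Complex.exp (((2 * (0 : ℕ) * (Real.pi / n) : ℝ) : ℂ) * Complex.I) ∈ convexHull ℝ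
      {w : ℂ | ∃ k < n, w = Complex.exp (2 * Real.pi * Complex.I / n) ^ k} :=
    subset_convexHull ℝ _ ⟨0, by omega, (exp_two_pi_mul_I_div_pow n 0).symm⟩
  have h2 : Complex.exp (((2 * (1 : ℕ) * (Real.pi / n) : ℝ) : ℂ) * Complex.I) ∈ convexHull ℝ
      {w : ℂ | ∃ k < n, w = Complex.exp (2 * Real.pi * Complex.I / n) ^ k} :=
    subset_convexHull ℝ _ ⟨1, by omega, (exp_two_pi_mul_I_div_pow n 1).symm⟩
  set q := Real.pi / n with hq
  have hqn : n * q = Real.pi := by rw [hq]; field_simp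
  have hq0 : 0 < q := by positivity
  have hq3 : 3 * q ≤ Real.pi := by nlinarith
  rw [abs_le] at hφ
  have hc : 0 < Real.cos q := Real.cos_pos_of_mem_Ioo ⟨by linarith, by linarith⟩
  have hs : 0 < Real.sin q := Real.sin_pos_of_pos_of_lt_pi hq0 (by linarith)
  have hα : 0 ≤ Real.sin (q - φ) :=
    Real.sin_nonneg_of_nonneg_of_le_pi (by linarith) (by linarith)
  have hβ : 0 ≤ Real.sin (q + φ) :=
    Real.sin_nonneg_of_nonneg_of_le_pi (by linarith) (by linarith)
  have hconv := convex_convexHull ℝ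
    {w : ℂ | ∃ k < n, w = Complex.exp (2 * Real.pi * Complex.I / n) ^ k}
  set α := r * Real.sin (q - φ) / (2 * Real.sin q * Real.cos q) with hαd
  set β := r * Real.sin (q + φ) / (2 * Real.sin q * Real.cos q) with hβd
  have hα0 : 0 ≤ α := by positivity
  have hβ0 : 0 ≤ β := by positivity
  have hαβ : α + β = r * Real.cos φ / Real.cos q := by
    rw [hαd, hβd, Real.sin_sub, Real.sin_add]
    field_simp
    ring
  have hαβ1 : α + β ≤ 1 := by
    rw [hαβ, div_le_one hc]
    exact h
  have hmem := hconv.sum_mem (t := Finset.univ) (w := ![1 - α - β, α, β])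
    (z := ![0, Complex.exp (((2 * (0 : ℕ) * q : ℝ) : ℂ) * Complex.I),
      Complex.exp (((2 * (1 : ℕ) * q : ℝ) : ℂ) * Complex.I)])
    (by intro i _; fin_cases i <;> simp <;> linarith)
    (by simp only [Fin.sum_univ_three, Matrix.cons_val]; ring)
    (by intro i _; fin_cases i <;> assumption)
  convert hmem using 1
  have hsq := Real.sin_sq_add_cos_sq q
  simp only [Fin.sum_univ_three, Matrix.cons_val]
  apply Complex.ext
  · simp only [Complex.add_re, Complex.real_smul, Complex.re_ofReal_mul,
      Complex.exp_ofReal_mul_I_re, Complex.zero_re]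
    simp only [Nat.cast_zero, Nat.cast_one, mul_zero, zero_mul, mul_one, Real.cos_zero,
      Real.cos_two_mul]
    rw [hαd, hβd, Real.sin_sub, Real.sin_add, Real.cos_add]
    field_simp
    linear_combination (-2 * r * Real.cos q * Real.sin φ) * hsq
  · simp only [Complex.add_im, Complex.real_smul, Complex.im_ofReal_mul,
      Complex.exp_ofReal_mul_I_im, Complex.zero_im]
    simp only [Nat.cast_zero, Nat.cast_one, mul_zero, zero_mul, mul_one, Real.sin_zero,
      Real.sin_two_mul]
    rw [hβd, Real.sin_add, Real.sin_add]
    field_simp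
    ring

/-- Description of `𝒫_n^n`, for `n = m + 1`, as the intersection of its supporting half-planes. -/
lemma polygon_pow_eq_setOf (m : ℕ) (hm : 2 ≤ m) :
    ((fun z : ℂ => z ^ (m + 1)) '' convexHull ℝ
      {w : ℂ | ∃ k < m + 1, w = Complex.exp (2 * Real.pi * Complex.I / (m + 1 : ℕ)) ^ k})
    = {v : ℂ | ∀ a : ℝ, |a| ≤ Real.pi / (m + 1) →
        -(v.re * Real.cos (m * a) + v.im * Real.sin (m * a)) * Real.cos a ^ m
          ≤ Real.cos (Real.pi / (m + 1)) ^ (m + 1)} := by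
  have hm' : (2 : ℝ) ≤ m := by exact_mod_cast hm
  have hpi := Real.pi_pos
  have hqn : (m + 1) * (Real.pi / (m + 1)) = Real.pi := by field_simp
  have hq0 : 0 < Real.pi / (m + 1) := by positivity
  have hq2 : Real.pi / (m + 1) ≤ Real.pi / 2 := by nlinarith
  have hpow (r φ : ℝ) : ((r : ℂ) * Complex.exp (((φ + Real.pi / (m + 1) : ℝ) : ℂ) * Complex.I))
      ^ (m + 1) = -((r ^ (m + 1) : ℝ) : ℂ) *
        Complex.exp ((((m + 1) * φ : ℝ) : ℂ) * Complex.I) := by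
    have hqn' : ((m : ℂ) + 1) * (Real.pi / (m + 1)) = Real.pi := by exact_mod_cast hqn
    have e : (((m + 1 : ℕ) : ℂ) * (((φ + Real.pi / (m + 1) : ℝ) : ℂ) * Complex.I))
        = (((m + 1) * φ : ℝ) : ℂ) * Complex.I + Real.pi * Complex.I := by
      push_cast
      linear_combination Complex.I * hqn'
    rw [mul_pow, ← Complex.exp_nat_mul, e, Complex.exp_add, Complex.exp_pi_mul_I]
    push_cast
    ring
  apply Set.Subset.antisymm
  · rintro _ ⟨z, hz, rfl⟩ a ha
    set q := Real.pi / (m + 1) with hq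
    set k := ⌊z.arg / (2 * q)⌋
    have hk1 : k * (2 * q) ≤ z.arg := (le_div_iff₀ (by positivity)).1 (Int.floor_le _)
    have hk2 : z.arg < (k + 1) * (2 * q) := (div_lt_iff₀ (by positivity)).1 (Int.lt_floor_add_one _)
    set φ := z.arg - (2 * k + 1) * q with hφd
    have hφ : |φ| ≤ q := by
      rw [abs_le]
      constructor <;> linarith
    have hcosφ : 0 ≤ Real.cos φ := by
      rw [abs_le] at hφ
      exact Real.cos_nonneg_of_neg_pi_div_two_le_of_le (by linarith) (by linarith)
    have hedge := re_mul_cos_add_im_mul_sin_le_of_mem_polygon (m + 1) (by omega) (2 * k + 1)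
      ⟨k, rfl⟩ hz
    push_cast at hedge
    rw [← hq, ← Complex.norm_mul_cos_arg z, ← Complex.norm_mul_sin_arg z, mul_assoc, mul_assoc,
      ← mul_add, ← Real.cos_sub, ← hφd] at hedge
    have hzpow : z ^ (m + 1) = -((‖z‖ ^ (m + 1) : ℝ) : ℂ) *
        Complex.exp ((((m + 1) * φ : ℝ) : ℂ) * Complex.I) := by
      have e : z ^ (m + 1) = ((‖z‖ : ℂ) *
          Complex.exp (((φ + q : ℝ) : ℂ) * Complex.I)) ^ (m + 1) := by
        conv_lhs => rw [← Complex.norm_mul_exp_arg_mul_I z]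
        rw [mul_pow, mul_pow, ← Complex.exp_nat_mul, ← Complex.exp_nat_mul]
        congr 1
        rw [Complex.exp_eq_exp_iff_exists_int]
        refine ⟨k, ?_⟩
        rw [← hqn, hφd]
        push_cast
        ring
      rw [e, hpow]
    have hv (x : ℝ) : -((z ^ (m + 1)).re * Real.cos x + (z ^ (m + 1)).im * Real.sin x)
        = ‖z‖ ^ (m + 1) * Real.cos ((m + 1) * φ - x) := by
      rw [hzpow, ← Complex.ofReal_neg, Complex.re_ofReal_mul, Complex.im_ofReal_mul,
        Complex.exp_ofReal_mul_I_re, Complex.exp_ofReal_mul_I_im, Real.cos_sub]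
      ring
    change -((z ^ (m + 1)).re * _ + (z ^ (m + 1)).im * _) * _ ≤ _
    rw [hv, mul_assoc]
    calc ‖z‖ ^ (m + 1) * (Real.cos ((m + 1) * φ - m * a) * Real.cos a ^ m)
        ≤ ‖z‖ ^ (m + 1) * Real.cos φ ^ (m + 1) := by
          gcongr
          exact cos_mul_sub_mul_cos_pow_le m (by omega) ha hφ
      _ = (‖z‖ * Real.cos φ) ^ (m + 1) := by ring
      _ ≤ Real.cos q ^ (m + 1) := by gcongr
  · intro v hv
    set q := Real.pi / (m + 1) with hq
    set φ := (-v).arg / (m + 1) with hφd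
    have hφm : (m + 1) * φ = (-v).arg := by rw [hφd]; field_simp
    have hφ : |φ| ≤ q := by
      rw [hφd, abs_div, abs_of_pos (by positivity : (0 : ℝ) < m + 1), hq]
      gcongr
      exact Complex.abs_arg_le_pi _
    obtain ⟨r, hr, hrpow⟩ : ∃ r : ℝ, 0 ≤ r ∧ r ^ (m + 1) = ‖-v‖ :=
      ⟨‖-v‖ ^ (((m + 1 : ℕ) : ℝ)⁻¹), by positivity,
        Real.rpow_inv_natCast_pow (norm_nonneg _) (by omega)⟩
    refine ⟨(r : ℂ) * Complex.exp (((φ + q : ℝ) : ℂ) * Complex.I), ?_, ?_⟩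
    · have hmem := mul_exp_mem_polygon (m + 1) (by omega) hr (φ := φ)
        (by push_cast; exact hφ) ?_
      · push_cast at hmem ⊢
        rw [hq]
        push_cast
        exact hmem
      · push_cast
        rw [← hq]
        have hc : 0 ≤ Real.cos q :=
          Real.cos_nonneg_of_neg_pi_div_two_le_of_le (by linarith) (by linarith)
        refine le_of_pow_le_pow_left₀ (n := m + 1) (by omega) hc (le_trans (le_of_eq ?_) (hv φ hφ))
        have hre := Complex.norm_mul_cos_arg (-v)
        have him := Complex.norm_mul_sin_arg (-v)
        rw [Complex.neg_re] at hre
        rw [Complex.neg_im] at him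
        have hcos : ‖-v‖ * Real.cos φ
            = -(v.re * Real.cos (m * φ) + v.im * Real.sin (m * φ)) := by
          have e : φ = (-v).arg - m * φ := by linear_combination hφm
          conv_lhs => rw [e, Real.cos_sub]
          linear_combination Real.cos (m * φ) * hre + Real.sin (m * φ) * him
        rw [mul_pow, hrpow, ← hcos]
        ring
    · change _ ^ (m + 1) = _
      rw [hpow, hrpow, hφm, neg_mul, Complex.norm_mul_exp_arg_mul_I, neg_neg]

lemma polygon_two_pow_eq : ((fun z : ℂ => z ^ 2) '' convexHull ℝ
      {w : ℂ | ∃ k < 2, w = Complex.exp (2 * Real.pi * Complex.I / (2 : ℕ)) ^ k})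
    = segment ℝ 0 1 := by
  have hset : {w : ℂ | ∃ k < 2, w = Complex.exp (2 * Real.pi * Complex.I / (2 : ℕ)) ^ k}
      = {1, -1} := by
    have e : Complex.exp (2 * Real.pi * Complex.I / (2 : ℕ)) = -1 := by
      rw [← Complex.exp_pi_mul_I]
      congr 1
      push_cast
      ring
    ext w
    rw [e]
    constructor
    · rintro ⟨k, hk, rfl⟩
      interval_cases k <;> simp
    · rintro (rfl | rfl)
      · exact ⟨0, by simp⟩
      · exact ⟨1, by simp⟩
  rw [hset, convexHull_pair]
  ext v
  constructor
  · rintro ⟨_, ⟨s, t, hs, ht, hst, rfl⟩, rfl⟩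
    obtain rfl : t = 1 - s := by linarith
    refine ⟨1 - (s - (1 - s)) ^ 2, (s - (1 - s)) ^ 2, by nlinarith, by positivity, by ring, ?_⟩
    simp only [Complex.real_smul]
    push_cast
    ring
  · rintro ⟨s, t, hs, ht, hst, rfl⟩
    have h1 : √t ≤ 1 := Real.sqrt_le_one.2 (by linarith)
    have h0 := Real.sqrt_nonneg t
    refine ⟨_, ⟨(1 + √t) / 2, (1 - √t) / 2, by linarith, by linarith, by ring, rfl⟩, ?_⟩
    have hsq : (√t : ℂ) ^ 2 = t := by
      exact_mod_cast Real.sq_sqrt ht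
    simp only [Complex.real_smul]
    push_cast
    linear_combination hsq

/-- The set `𝒫_n^n`, the image of the unit `n`-gon under `z ↦ z^n`, is convex. -/
theorem polygon_pow_convex (n : ℕ) (hn : 1 ≤ n) :
    Convex ℝ ((fun z : ℂ => z ^ n) '' convexHull ℝ
      {w : ℂ | ∃ k < n, w = Complex.exp (2 * Real.pi * Complex.I / n) ^ k}) := by
  obtain ⟨m, rfl⟩ : ∃ m, n = m + 1 := ⟨n - 1, by omega⟩
  rcases lt_trichotomy m 1 with h | rfl | h
  · obtain rfl : m = 0 := by omega
    simp
  · exact polygon_two_pow_eq ▸ convex_segment 0 1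
  · rw [polygon_pow_eq_setOf m h]
    intro x hx y hy s t hs ht hst a ha
    have h1 := mul_le_mul_of_nonneg_left (hx a ha) hs
    have h2 := mul_le_mul_of_nonneg_left (hy a ha) ht
    obtain rfl : t = 1 - s := by linarith
    simp only [Complex.add_re, Complex.add_im, Complex.real_smul, Complex.re_ofReal_mul,
      Complex.im_ofReal_mul]
    linarith
end

section
/- Let n ≥ 3 and ω_n = exp(2πi/n). Then the image under z ↦ z^n of the edge of the regular n-gon joining 1 to ω_n coincides with the secant-parametrized curve: {((1−t) + t·ω_n)^n : t ∈ [0,1]} = { −(sec(θ/n)/sec(π/n))^n · exp(iθ) : θ ∈ [−π, π] } as subsets of ℂ. -/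
/-- A point of the chord from `1` to `exp (2 * a * I)`, in polar form about the direction of the
midpoint of the chord. -/
lemma chord_eq_polar {a φ t : ℝ} (ha : Real.cos a ≠ 0) (hφ : Real.cos φ ≠ 0)
    (h : Real.tan φ = (2 * t - 1) * Real.tan a) :
    ((1 - t : ℝ) + (t : ℝ) * Complex.exp (2 * a * Complex.I) : ℂ) =
      ((Real.cos φ)⁻¹ / (Real.cos a)⁻¹ : ℝ) * Complex.exp (φ * Complex.I) *
        Complex.exp (a * Complex.I) := by
  have hsin : Real.sin φ = (2 * t - 1) * (Real.sin a / Real.cos a) * Real.cos φ := by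
    rw [← Real.tan_eq_sin_div_cos, ← h, Real.tan_mul_cos hφ]
  have hpyth : (Real.sin a : ℂ) ^ 2 + (Real.cos a : ℂ) ^ 2 = 1 := by
    exact_mod_cast Real.sin_sq_add_cos_sq a
  have hexp : Complex.exp (2 * a * Complex.I) = Complex.exp (a * Complex.I) ^ 2 := by
    rw [← Complex.exp_nat_mul]
    push_cast
    ring_nf
  rw [hexp, Complex.exp_mul_I, Complex.exp_mul_I, ← Complex.ofReal_cos, ← Complex.ofReal_sin,
    ← Complex.ofReal_cos, ← Complex.ofReal_sin, hsin]
  have ha' : (Real.cos a : ℂ) ≠ 0 := by exact_mod_cast ha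
  have hφ' : (Real.cos φ : ℂ) ≠ 0 := by exact_mod_cast hφ
  generalize Real.cos a = c at *
  generalize Real.sin a = s at *
  generalize Real.cos φ = d at *
  push_cast
  field_simp
  linear_combination (t - 1 : ℂ) * hpyth + (s ^ 2 * (1 - t) : ℂ) * Complex.I_sq

/-- The `n`-th power of a point of the edge of the regular `n`-gon, in polar form. -/
lemma edge_point_pow_eq {n : ℕ} (hn : n ≠ 0) {θ t : ℝ} (ha : Real.cos (Real.pi / n) ≠ 0)
    (hθ : Real.cos (θ / n) ≠ 0)
    (h : Real.tan (θ / n) = (2 * t - 1) * Real.tan (Real.pi / n)) :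
    ((1 - t : ℝ) + (t : ℝ) * Complex.exp (2 * Real.pi * Complex.I / n) : ℂ) ^ n =
      -((((Real.cos (θ / n))⁻¹ / (Real.cos (Real.pi / n))⁻¹) ^ n : ℝ) : ℂ) *
        Complex.exp (θ * Complex.I) := by
  have hn' : (n : ℂ) ≠ 0 := by exact_mod_cast hn
  have hpow (x : ℝ) : Complex.exp ((x / n : ℝ) * Complex.I) ^ n = Complex.exp (x * Complex.I) := by
    rw [← Complex.exp_nat_mul]
    congr 1
    push_cast
    field_simp
  have harg : 2 * Real.pi * Complex.I / n = 2 * (Real.pi / n : ℝ) * Complex.I := by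
    push_cast
    ring
  rw [harg, chord_eq_polar ha hθ h, mul_pow, mul_pow, hpow, hpow, Complex.exp_pi_mul_I,
    Complex.ofReal_pow]
  ring

/-- The image under `z ↦ z^n` of the edge of the regular `n`-gon joining `1` to `ω_n`
coincides with the secant-parametrized boundary curve. -/
theorem edge_pow_eq_secant_curve (n : ℕ) (hn : 3 ≤ n) :
    {w : ℂ | ∃ t ∈ Set.Icc (0 : ℝ) 1,
        w = ((1 - t : ℝ) + (t : ℝ) * Complex.exp (2 * Real.pi * Complex.I / n)) ^ n} =
    {w : ℂ | ∃ θ ∈ Set.Icc (-Real.pi) Real.pi,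
        w = -((((Real.cos (θ / n))⁻¹ / (Real.cos (Real.pi / n))⁻¹) ^ n : ℝ) : ℂ) *
          Complex.exp (θ * Complex.I)} := by
  have hn0 : n ≠ 0 := by omega
  have hn3 : (3 : ℝ) ≤ n := by exact_mod_cast hn
  have hnpos : (0 : ℝ) < n := by linarith
  have hapos : 0 < Real.pi / n := div_pos Real.pi_pos hnpos
  have halt : Real.pi / n < Real.pi / 2 :=
    div_lt_div_of_pos_left Real.pi_pos two_pos (by linarith)
  have hcos : Real.cos (Real.pi / n) ≠ 0 :=
    (Real.cos_pos_of_mem_Ioo ⟨by linarith, halt⟩).ne'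
  have htan : 0 < Real.tan (Real.pi / n) := Real.tan_pos_of_pos_of_lt_pi_div_two hapos halt
  have harctan : Real.arctan (Real.tan (Real.pi / n)) = Real.pi / n :=
    Real.arctan_tan (by linarith) halt
  ext w
  constructor
  · rintro ⟨t, ⟨ht0, ht1⟩, rfl⟩
    set φ := Real.arctan ((2 * t - 1) * Real.tan (Real.pi / n)) with hφ
    have hle : φ ≤ Real.pi / n := by
      rw [← harctan]
      exact Real.arctan_strictMono.monotone (by nlinarith)
    have hge : -(Real.pi / n) ≤ φ := by
      rw [← harctan, ← Real.arctan_neg]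
      exact Real.arctan_strictMono.monotone (by nlinarith)
    have hdiv : n * φ / n = φ := mul_div_cancel_left₀ φ hnpos.ne'
    refine ⟨n * φ, ⟨?_, ?_⟩, edge_point_pow_eq hn0 hcos ?_ ?_⟩
    · rw [← neg_div, div_le_iff₀ hnpos] at hge
      linarith
    · rw [le_div_iff₀ hnpos] at hle
      linarith
    · rw [hdiv]
      exact (Real.cos_arctan_pos _).ne'
    · rw [hdiv, hφ, Real.tan_arctan]
  · rintro ⟨θ, ⟨hθ0, hθ1⟩, rfl⟩
    have hle : θ / n ≤ Real.pi / n := by gcongr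
    have hge : -(Real.pi / n) ≤ θ / n := by
      rw [← neg_div]
      gcongr
    have hmem : θ / n ∈ Set.Ioo (-(Real.pi / 2)) (Real.pi / 2) := ⟨by linarith, by linarith⟩
    have htle : Real.tan (θ / n) ≤ Real.tan (Real.pi / n) :=
      Real.strictMonoOn_tan.monotoneOn hmem ⟨by linarith, halt⟩ hle
    have htge : -Real.tan (Real.pi / n) ≤ Real.tan (θ / n) := by
      rw [← Real.tan_neg]
      exact Real.strictMonoOn_tan.monotoneOn ⟨by linarith, by linarith⟩ hmem hge
    have hqle : Real.tan (θ / n) / Real.tan (Real.pi / n) ≤ 1 := (div_le_one htan).2 htle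
    have hqge : -1 ≤ Real.tan (θ / n) / Real.tan (Real.pi / n) := by
      rw [le_div_iff₀ htan]
      linarith
    refine ⟨(1 + Real.tan (θ / n) / Real.tan (Real.pi / n)) / 2, ⟨by linarith, by linarith⟩,
      (edge_point_pow_eq hn0 hcos (Real.cos_pos_of_mem_Ioo hmem).ne' ?_).symm⟩
    field_simp
    ring
end

section
/- For every n ≥ 2, the complex number 0 lies in the convex hull (in ℂ viewed as a real vector space) of the three points 1, ω_n, and ω_n^{⌈n/2⌉}, where ω_n = exp(2πi/n). Consequently, every point of the triangle conv{0, 1, ω_n} is a convex combination of 1, ω_n, and ω_n^{⌈n/2⌉}. -/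
/-- A vanishing nonnegative combination of three points with positive total weight places `0`
in their convex hull. -/
theorem zero_mem_convexHull_triple {E : Type*} [AddCommGroup E] [Module ℝ E] {x y z : E}
    {a b c : ℝ} (ha : 0 ≤ a) (hb : 0 ≤ b) (hc : 0 ≤ c) (hpos : 0 < a + b + c)
    (h : a • x + b • y + c • z = 0) : (0 : E) ∈ convexHull ℝ ({x, y, z} : Set E) := by
  have key := (convex_convexHull ℝ ({x, y, z} : Set E)).centerMass_mem
    (t := Finset.univ) (w := ![a, b, c]) (z := ![x, y, z])
    (by intro i _; fin_cases i <;> assumption)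
    (by simpa [Fin.sum_univ_three] using hpos)
    (by intro i _; apply subset_convexHull; fin_cases i <;> simp)
  simpa [Finset.centerMass, Fin.sum_univ_three, h] using key

/-- The convex hull of `1`, `ω_n` and `ω_n ^ ⌈n/2⌉` contains the origin. -/
theorem zero_mem_convexHull_one_root_pow (n : ℕ) (hn : 2 ≤ n) :
    (0 : ℂ) ∈ convexHull ℝ
        ({1, Complex.exp (2 * Real.pi * Complex.I / n),
          Complex.exp (2 * Real.pi * Complex.I / n) ^ ((n + 1) / 2)} : Set ℂ) := by
  have hn0 : (n : ℂ) ≠ 0 := by exact_mod_cast (by omega : n ≠ 0)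
  have hsq : Complex.exp (2 * Real.pi * Complex.I / n) =
      Complex.exp ((Real.pi / n : ℝ) * Complex.I) ^ 2 := by
    rw [← Complex.exp_nat_mul]
    push_cast
    ring_nf
  have hpow : Complex.exp ((Real.pi / n : ℝ) * Complex.I) ^ n = -1 := by
    rw [← Complex.exp_nat_mul, ← Complex.exp_pi_mul_I]
    push_cast
    field_simp
  have hcos : 2 * (Real.cos (Real.pi / n) : ℂ) * Complex.exp ((Real.pi / n : ℝ) * Complex.I) =
      Complex.exp ((Real.pi / n : ℝ) * Complex.I) ^ 2 + 1 := by
    rw [Complex.ofReal_cos, Complex.two_cos, add_mul, neg_mul, ← Complex.exp_add (-_),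
      neg_add_cancel, Complex.exp_zero, sq]
  have hcos_nonneg : 0 ≤ Real.cos (Real.pi / n) := by
    apply Real.cos_nonneg_of_neg_pi_div_two_le_of_le
    · have : 0 ≤ Real.pi / n := by positivity
      linarith [Real.pi_pos]
    · have : (2 : ℝ) ≤ n := by exact_mod_cast hn
      gcongr
  rw [hsq, ← pow_mul]
  rcases Nat.even_or_odd n with heven | hodd
  · rw [show 2 * ((n + 1) / 2) = n by grind, hpow]
    exact zero_mem_convexHull_triple zero_le_one le_rfl zero_le_one (by norm_num) (by simp)
  · rw [show 2 * ((n + 1) / 2) = n + 1 by grind, pow_succ _ n, hpow]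
    refine zero_mem_convexHull_triple (c := 2 * Real.cos (Real.pi / n)) zero_le_one zero_le_one
      (by positivity) (by positivity) ?_
    simp only [Complex.real_smul]
    push_cast at hcos ⊢
    linear_combination -hcos

/-- `0` lies in the convex hull of `{1, ω_n, ω_n^⌈n/2⌉}`; consequently every point of
the triangle `conv{0, 1, ω_n}` is a convex combination of `1`, `ω_n`, `ω_n^⌈n/2⌉`. -/
theorem zero_mem_convexHull_three_roots (n : ℕ) (hn : 2 ≤ n) :
    (0 : ℂ) ∈ convexHull ℝ
        ({1, Complex.exp (2 * Real.pi * Complex.I / n),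
          Complex.exp (2 * Real.pi * Complex.I / n) ^ ((n + 1) / 2)} : Set ℂ) ∧
    ∀ z ∈ convexHull ℝ ({0, 1, Complex.exp (2 * Real.pi * Complex.I / n)} : Set ℂ),
      z ∈ convexHull ℝ
        ({1, Complex.exp (2 * Real.pi * Complex.I / n),
          Complex.exp (2 * Real.pi * Complex.I / n) ^ ((n + 1) / 2)} : Set ℂ) := by
  have hzero := zero_mem_convexHull_one_root_pow n hn
  refine ⟨hzero, fun z hz => convexHull_min ?_ (convex_convexHull ℝ _) hz⟩
  rintro w (rfl | rfl | rfl)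
  · exact hzero
  · exact subset_convexHull ℝ _ (by simp)
  · exact subset_convexHull ℝ _ (by simp)
end

section
/- Let n ≥ 1, d ≥ 1, and let ρ : Fin n → Matrix (Fin d) (Fin d) ℂ be density matrices (each ρ i positive semidefinite with trace 1). Then there exists z in the convex hull 𝒫_n of the n-th roots of unity such that z^n = Tr(ρ 0 · ρ 1 ⋯ ρ (n−1)). That is, every Bargmann invariant of order n, pure or mixed, lies in 𝒫_n^n = {z^n : z ∈ 𝒫_n}. -/
open scoped BigOperators ComplexOrder

/-- A convex set containing the values of a multilinear map on a set also contains its values on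
the convex hull of that set. -/
theorem Convex.multilinearMap_mem {ι M E : Type*} [Fintype ι] [DecidableEq ι]
    [AddCommGroup M] [Module ℝ M] [AddCommGroup E] [Module ℝ E]
    (f : MultilinearMap ℝ (fun _ : ι => M) E) {S : Set E} (hS : Convex ℝ S) {T : Set M}
    (h : ∀ g : ι → M, (∀ i, g i ∈ T) → f g ∈ S) (ρ : ι → M)
    (hρ : ∀ i, ρ i ∈ convexHull ℝ T) : f ρ ∈ S := by
  suffices H : ∀ s : Finset ι, ∀ ρ : ι → M, (∀ i, ρ i ∈ convexHull ℝ T) →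
      (∀ i ∉ s, ρ i ∈ T) → f ρ ∈ S from
    H Finset.univ ρ hρ fun i hi => absurd (Finset.mem_univ i) hi
  intro s
  induction s using Finset.induction_on with
  | empty => exact fun ρ _ h' => h ρ fun i => h' i (Finset.notMem_empty i)
  | insert i s _ ih =>
    intro ρ hρ hT
    have hsub : T ⊆ f.toLinearMap ρ i ⁻¹' S := by
      intro x hx
      refine ih (Function.update ρ i x) (fun j => ?_) (fun j hj => ?_)
      · rcases eq_or_ne j i with rfl | hji
        · simpa using subset_convexHull ℝ T hx
        · simpa [hji] using hρ j
      · rcases eq_or_ne j i with rfl | hji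
        · simpa using hx
        · simpa [hji] using hT j (by simp [hji, hj])
    have := convexHull_min hsub (hS.linear_preimage _) (hρ i)
    simpa using this

/-- A density matrix is a convex combination of pure states. -/
theorem Matrix.PosSemidef.mem_convexHull_pure {ι : Type*} [Fintype ι] [DecidableEq ι]
    {A : Matrix ι ι ℂ} (hA : A.PosSemidef) (htr : A.trace = 1) :
    A ∈ convexHull ℝ {P : Matrix ι ι ℂ | ∃ v : EuclideanSpace ℂ ι, ‖v‖ = 1 ∧
      P = Matrix.vecMulVec v.ofLp (star v.ofLp)} := by
  have hsum : A = ∑ k, hA.1.eigenvalues k •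
      Matrix.vecMulVec (hA.1.eigenvectorBasis k).ofLp (star (hA.1.eigenvectorBasis k).ofLp) := by
    conv_lhs => rw [hA.1.spectral_theorem]
    ext i j
    rw [Unitary.conjStarAlgAut_apply, Matrix.mul_apply]
    simp only [Matrix.mul_diagonal, Matrix.sum_apply, Matrix.smul_apply, Matrix.vecMulVec_apply,
      Matrix.IsHermitian.eigenvectorUnitary_apply, Matrix.star_apply, Pi.star_apply]
    refine Finset.sum_congr rfl fun k _ => ?_
    simp
    ring
  rw [hsum]
  refine (convex_convexHull ℝ _).sum_mem (fun k _ => hA.eigenvalues_nonneg k) ?_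
    fun k _ => subset_convexHull ℝ _ ⟨_, hA.1.eigenvectorBasis.orthonormal.1 k, rfl⟩
  have := hA.1.trace_eq_sum_eigenvalues.symm.trans htr
  exact Complex.ofReal_injective (by simpa using this)

/-- The product of pure states, expressed through consecutive inner products. -/
theorem Matrix.prod_ofFn_vecMulVec {ι : Type*} [Fintype ι] [DecidableEq ι]
    (v : ℕ → EuclideanSpace ℂ ι) (m : ℕ) :
    (List.ofFn fun i : Fin (m + 1) => Matrix.vecMulVec (v i).ofLp (star (v i).ofLp)).prod =
      (∏ k ∈ Finset.range m, inner ℂ (v k) (v (k + 1))) •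
        Matrix.vecMulVec (v 0).ofLp (star (v m).ofLp) := by
  induction m with
  | zero => simp
  | succ m ih =>
    rw [List.ofFn_succ', List.concat_eq_append, List.prod_append]
    simp only [Fin.val_castSucc, ih, List.prod_singleton, Fin.val_last, Matrix.smul_mul,
      Matrix.vecMulVec_mul_vecMulVec, Finset.prod_range_succ, mul_smul,
      EuclideanSpace.inner_eq_star_dotProduct]
    rw [dotProduct_comm, Matrix.vecMulVec_smul]

theorem Matrix.trace_prod_ofFn_vecMulVec {ι : Type*} [Fintype ι] [DecidableEq ι]
    (v : ℕ → EuclideanSpace ℂ ι) (m : ℕ) :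
    (List.ofFn fun i : Fin (m + 1) =>
        Matrix.vecMulVec (v i).ofLp (star (v i).ofLp)).prod.trace =
      (∏ k ∈ Finset.range m, inner ℂ (v k) (v (k + 1))) * inner ℂ (v m) (v 0) := by
  rw [Matrix.prod_ofFn_vecMulVec, Matrix.trace_smul, Matrix.trace_vecMulVec,
    EuclideanSpace.inner_eq_star_dotProduct, smul_eq_mul]

theorem arccos_re_inner_triangle {V : Type*} [NormedAddCommGroup V] [InnerProductSpace ℂ V]
    {x y z : V} (hx : ‖x‖ = 1) (hy : ‖y‖ = 1) (hz : ‖z‖ = 1) :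
    Real.arccos (inner ℂ x z).re ≤
      Real.arccos (inner ℂ x y).re + Real.arccos (inner ℂ y z).re := by
  let _ : InnerProductSpace ℝ V := InnerProductSpace.complexToReal
  have := InnerProductGeometry.angle_le_angle_add_angle x y z
  simpa [InnerProductGeometry.angle, hx, hy, hz, real_inner_eq_re_inner ℂ] using this

theorem cos_pow_mul_cos_le (m : ℕ) {t θ : ℝ} (ht : 0 ≤ t) (htm : t ≤ m * (Real.pi / 2))
    (hθ : 0 ≤ θ) (hθ' : θ ≤ Real.pi / 2) :
    Real.cos (t / m) ^ m * Real.cos θ ≤ Real.cos ((t + θ) / (m + 1)) ^ (m + 1) := by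
  have hπ := Real.pi_pos
  rcases Nat.eq_zero_or_pos m with rfl | hm
  · have : t = 0 := le_antisymm (by simpa using htm) ht
    simp [this]
  have hm' : (0 : ℝ) < m := by exact_mod_cast hm
  set x := t / m with hx
  have htx : t = m * x := by rw [hx]; field_simp
  have hx0 : 0 ≤ x := by positivity
  have hx1 : x ≤ Real.pi / 2 := by
    rw [hx, div_le_iff₀ hm']; linarith
  have hcx : 0 ≤ Real.cos x := Real.cos_nonneg_of_neg_pi_div_two_le_of_le (by linarith) hx1
  have hcθ : 0 ≤ Real.cos θ := Real.cos_nonneg_of_neg_pi_div_two_le_of_le (by linarith) hθ'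
  have hw : (m : ℝ) / (m + 1) + 1 / (m + 1) = 1 := by field_simp
  have hconc := strictConcaveOn_cos_Icc.concaveOn.2
    (show x ∈ Set.Icc (-(Real.pi / 2)) (Real.pi / 2) from ⟨by linarith, hx1⟩)
    (show θ ∈ Set.Icc (-(Real.pi / 2)) (Real.pi / 2) from ⟨by linarith, hθ'⟩)
    (show (0 : ℝ) ≤ (m : ℝ) / (m + 1) by positivity)
    (show (0 : ℝ) ≤ 1 / ((m : ℝ) + 1) by positivity) hw
  have hamgm := Real.geom_mean_le_arith_mean2_weighted
    (w₁ := (m : ℝ) / (m + 1)) (w₂ := 1 / (m + 1)) (by positivity) (by positivity) hcx hcθ hw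
  simp only [smul_eq_mul] at hconc
  have harg : (m : ℝ) / (m + 1) * x + 1 / (m + 1) * θ = (t + θ) / (m + 1) := by
    rw [htx]; field_simp
  rw [harg] at hconc
  have hpow := pow_le_pow_left₀ (by positivity) (hamgm.trans hconc) (m + 1)
  refine le_of_eq_of_le ?_ hpow
  rw [mul_pow, ← Real.rpow_natCast (_ ^ _), ← Real.rpow_natCast (Real.cos θ ^ _),
    ← Real.rpow_mul hcx, ← Real.rpow_mul hcθ]
  push_cast
  rw [div_mul_cancel₀ _ (by positivity), div_mul_cancel₀ _ (by positivity), Real.rpow_one,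
    Real.rpow_natCast]

/-- After adjusting phases so that consecutive overlaps have argument `β`, the product of the
overlaps of a chain of unit vectors is controlled by the angle between its ends. -/
theorem exists_phase_chain {V : Type*} [NormedAddCommGroup V] [InnerProductSpace ℂ V]
    (v : ℕ → V) (hv : ∀ k, ‖v k‖ = 1) {β : ℝ} (hβ : 0 ≤ Real.cos β) (m : ℕ) :
    ∃ a R t : ℝ, 0 ≤ R ∧ 0 ≤ t ∧ t ≤ m * (Real.pi / 2) ∧
      (∏ k ∈ Finset.range m, inner ℂ (v k) (v (k + 1))) * Complex.exp (a * Complex.I) =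
        R * Complex.exp (m * β * Complex.I) ∧
      Real.arccos (inner ℂ (v 0) (Complex.exp (a * Complex.I) • v m)).re ≤ t ∧
      R * Real.cos β ^ m ≤ Real.cos (t / m) ^ m := by
  induction m with
  | zero => exact ⟨0, 1, 0, by simp [hv]⟩
  | succ m ih =>
    obtain ⟨a, R, t, hR, ht, htm, hprod, hang, hbd⟩ := ih
    set x := inner ℂ (v m) (v (m + 1)) with hx
    obtain ⟨φ, hxpol⟩ : ∃ φ : ℝ, ‖x‖ * Complex.exp (φ * Complex.I) = x :=
      ⟨_, Complex.norm_mul_exp_arg_mul_I x⟩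
    have hr : 0 ≤ ‖x‖ * Real.cos β := by positivity
    have hθ' : Real.arccos (‖x‖ * Real.cos β) ≤ Real.pi / 2 := Real.arccos_le_pi_div_two.2 hr
    have hr1 : ‖x‖ * Real.cos β ≤ 1 := by
      have h1 : ‖x‖ ≤ 1 := by simpa [hv] using norm_inner_le_norm (𝕜 := ℂ) (v m) (v (m + 1))
      exact mul_le_one₀ h1 hβ (Real.cos_le_one β)
    have hinner : inner ℂ (Complex.exp (a * Complex.I) • v m)
        (Complex.exp ((a + β - φ : ℝ) * Complex.I) • v (m + 1)) =
          ‖x‖ * Complex.exp (β * Complex.I) := by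
      rw [inner_smul_left, inner_smul_right, ← hx, ← Complex.exp_conj]
      conv_lhs => rw [← hxpol]
      rw [mul_left_comm, mul_left_comm _ (‖x‖ : ℂ), mul_left_comm _ (‖x‖ : ℂ), ← Complex.exp_add,
        ← Complex.exp_add]
      congr 2
      simp
      ring
    refine ⟨a + β - φ, R * ‖x‖, t + Real.arccos (‖x‖ * Real.cos β), by positivity,
      add_nonneg ht (Real.arccos_nonneg _), ?_, ?_, ?_, ?_⟩
    · push_cast; linarith
    · rw [Finset.prod_range_succ, ← hx]
      have h1 : Complex.exp ((a + β - φ : ℝ) * Complex.I) * x =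
          Complex.exp (a * Complex.I) * (‖x‖ * Complex.exp (β * Complex.I)) := by
        conv_lhs => rw [← hxpol]
        rw [mul_left_comm, mul_left_comm _ (‖x‖ : ℂ), ← Complex.exp_add, ← Complex.exp_add]
        congr 2
        push_cast
        ring
      rw [mul_assoc, mul_comm x, h1, ← mul_assoc, hprod]
      have h2 : Complex.exp ((m + 1 : ℕ) * β * Complex.I) =
          Complex.exp (m * β * Complex.I) * Complex.exp (β * Complex.I) := by
        rw [← Complex.exp_add]; push_cast; ring_nf
      rw [h2]; push_cast; ring
    · refine (arccos_re_inner_triangle (hv 0) (y := Complex.exp (a * Complex.I) • v m) ?_ ?_).trans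
        (add_le_add hang (le_of_eq ?_))
      · rw [norm_smul, Complex.norm_exp_ofReal_mul_I, hv, one_mul]
      · rw [norm_smul, Complex.norm_exp_ofReal_mul_I, hv, one_mul]
      · rw [hinner, Complex.re_ofReal_mul, Complex.exp_ofReal_mul_I_re]
    · have hcos : Real.cos (Real.arccos (‖x‖ * Real.cos β)) = ‖x‖ * Real.cos β :=
        Real.cos_arccos (by linarith) hr1
      have := cos_pow_mul_cos_le m ht htm (Real.arccos_nonneg (‖x‖ * Real.cos β)) hθ'
      rw [hcos] at this
      push_cast
      refine le_trans ?_ this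
      calc R * ‖x‖ * Real.cos β ^ (m + 1) = R * Real.cos β ^ m * (‖x‖ * Real.cos β) := by ring
        _ ≤ _ := mul_le_mul_of_nonneg_right hbd hr

/-- The supporting half-planes of the set of pure Bargmann invariants. -/
theorem re_pure_bargmann_le {V : Type*} [NormedAddCommGroup V] [InnerProductSpace ℂ V]
    (v : ℕ → V) (hv : ∀ k, ‖v k‖ = 1) {β : ℝ} (hβ : 0 ≤ Real.cos β) {m : ℕ} (hm : 1 ≤ m) :
    (-((∏ k ∈ Finset.range m, inner ℂ (v k) (v (k + 1))) * inner ℂ (v m) (v 0)) *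
        Complex.exp (-(m * β * Complex.I))).re * Real.cos β ^ m ≤
      Real.cos (Real.pi / (m + 1)) ^ (m + 1) := by
  have hπ := Real.pi_pos
  have hm' : (1 : ℝ) ≤ m := by exact_mod_cast hm
  obtain ⟨a, R, t, hR, ht, htm, hprod, hang, hbd⟩ := exists_phase_chain v hv hβ m
  set u := Complex.exp (a * Complex.I) • v m with hu
  have hun : ‖u‖ = 1 := by rw [hu, norm_smul, Complex.norm_exp_ofReal_mul_I, hv, one_mul]
  set P := ∏ k ∈ Finset.range m, inner ℂ (v k) (v (k + 1)) with hP
  have hw : -(P * inner ℂ (v m) (v 0)) * Complex.exp (-(m * β * Complex.I)) =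
      R * inner ℂ u (-v 0) := by
    have h1 : inner ℂ (v m) (v 0) = Complex.exp (a * Complex.I) * inner ℂ u (v 0) := by
      rw [hu, inner_smul_left, ← Complex.exp_conj, ← mul_assoc, ← Complex.exp_add]
      simp
    rw [inner_neg_right, h1, ← mul_assoc, hprod, Complex.exp_neg]
    field_simp
  rw [hw, Complex.re_ofReal_mul]
  set q := (inner ℂ u (-v 0)).re with hq
  have hq1 : q ≤ 1 := by
    refine (Complex.re_le_norm _).trans ?_
    simpa [hv, hun] using norm_inner_le_norm (𝕜 := ℂ) u (-v 0)
  have hpole : Real.pi / (m + 1) ≤ Real.pi / 2 := by gcongr; linarith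
  have hc : 0 ≤ Real.cos (Real.pi / (m + 1)) :=
    Real.cos_nonneg_of_neg_pi_div_two_le_of_le
      (le_trans (by linarith) (show (0 : ℝ) ≤ Real.pi / (m + 1) by positivity)) hpole
  rcases le_total q 0 with hq0 | hq0
  · refine le_trans ?_ (pow_nonneg hc _)
    exact mul_nonpos_of_nonpos_of_nonneg (mul_nonpos_of_nonneg_of_nonpos hR hq0) (by positivity)
  · have hθ' : Real.arccos q ≤ Real.pi / 2 := Real.arccos_le_pi_div_two.2 hq0
    have htri : Real.pi ≤ t + Real.arccos q := by
      have := arccos_re_inner_triangle (hv 0) hun (show ‖-v 0‖ = 1 by rw [norm_neg, hv])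
      rw [inner_neg_right, inner_self_eq_norm_sq_to_K, hv] at this
      simp only [Complex.coe_algebraMap, Complex.ofReal_one, one_pow, Complex.neg_re,
        Complex.one_re, Real.arccos_neg_one] at this
      exact this.trans (add_le_add_left hang _)
    calc R * q * Real.cos β ^ m = R * Real.cos β ^ m * q := by ring
      _ ≤ Real.cos (t / m) ^ m * q := mul_le_mul_of_nonneg_right hbd hq0
      _ = Real.cos (t / m) ^ m * Real.cos (Real.arccos q) := by
          rw [Real.cos_arccos (by linarith) hq1]
      _ ≤ Real.cos ((t + Real.arccos q) / (m + 1)) ^ (m + 1) :=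
          cos_pow_mul_cos_le m ht htm (Real.arccos_nonneg q) hθ'
      _ ≤ _ := by
          have hs : (t + Real.arccos q) / (m + 1) ≤ Real.pi / 2 := by
            rw [div_le_iff₀ (by linarith)]; linarith
          refine pow_le_pow_left₀ (Real.cos_nonneg_of_neg_pi_div_two_le_of_le ?_ hs) ?_ _
          · have : 0 ≤ (t + Real.arccos q) / (m + 1) := div_nonneg (by linarith) (by linarith)
            linarith
          · exact Real.cos_le_cos_of_nonneg_of_le_pi (by positivity) (by linarith) (by gcongr)

theorem norm_pure_bargmann_le_one {V : Type*} [NormedAddCommGroup V] [InnerProductSpace ℂ V]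
    (v : ℕ → V) (hv : ∀ k, ‖v k‖ = 1) (m : ℕ) :
    ‖(∏ k ∈ Finset.range m, inner ℂ (v k) (v (k + 1))) * inner ℂ (v m) (v 0)‖ ≤ 1 := by
  have h (i j : ℕ) : ‖inner ℂ (v i) (v j)‖ ≤ 1 := by
    simpa [hv] using norm_inner_le_norm (𝕜 := ℂ) (v i) (v j)
  rw [norm_mul, norm_prod]
  exact mul_le_one₀ (Finset.prod_le_one (fun _ _ => norm_nonneg _) fun _ _ => h _ _)
    (norm_nonneg _) (h _ _)

/-- A convex set containing every pure Bargmann invariant of order `m + 1` contains every mixed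
one. -/
theorem Convex.mixed_bargmann_mem {S : Set ℂ} (hS : Convex ℝ S) {ι : Type*} [Fintype ι]
    [DecidableEq ι] {m : ℕ}
    (h : ∀ v : ℕ → EuclideanSpace ℂ ι, (∀ k, ‖v k‖ = 1) →
      (∏ k ∈ Finset.range m, inner ℂ (v k) (v (k + 1))) * inner ℂ (v m) (v 0) ∈ S)
    {ρ : Fin (m + 1) → Matrix ι ι ℂ}
    (hpsd : ∀ i, (ρ i).PosSemidef) (htr : ∀ i, (ρ i).trace = 1) :
    (List.ofFn ρ).prod.trace ∈ S := by
  have := hS.multilinearMap_mem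
    ((Matrix.traceLinearMap ι ℝ ℂ).compMultilinearMap
      (MultilinearMap.mkPiAlgebraFin ℝ (m + 1) (Matrix ι ι ℂ)))
    (T := {P | ∃ v : EuclideanSpace ℂ ι, ‖v‖ = 1 ∧
      P = Matrix.vecMulVec v.ofLp (star v.ofLp)}) ?_ ρ
    fun i => (hpsd i).mem_convexHull_pure (htr i)
  · simpa using this
  · intro g hg
    choose v hv hgv using hg
    have := h (fun k => v (Fin.ofNat (m + 1) k)) (fun k => hv _)
    rw [← Matrix.trace_prod_ofFn_vecMulVec (fun k => v (Fin.ofNat (m + 1) k))] at this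
    rw [show g = _ from funext hgv]
    simpa using this

/-- A point of the sector `0 ≤ arg ≤ 2π/n` below the edge joining `1` to `ω_n` lies in `𝒫_n`. -/
theorem mem_polygon_of_re_le {n : ℕ} (hn : 2 ≤ n) {r β : ℝ} (hr : 0 ≤ r) (hr1 : r ≤ 1)
    (hβ : |β| ≤ Real.pi / n) (h : r * Real.cos β ≤ Real.cos (Real.pi / n)) :
    (r : ℂ) * Complex.exp ((β + Real.pi / n : ℝ) * Complex.I) ∈ convexHull ℝ
      {w : ℂ | ∃ k < n, w = Complex.exp (2 * Real.pi * Complex.I / n) ^ k} := by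
  have hπ := Real.pi_pos
  have hn' : (2 : ℝ) ≤ n := by exact_mod_cast hn
  set S := {w : ℂ | ∃ k < n, w = Complex.exp (2 * Real.pi * Complex.I / n) ^ k} with hS
  set ω := Complex.exp (2 * Real.pi * Complex.I / n) with hω
  set α := Real.pi / n with hα
  have hα0 : 0 < α := by positivity
  have hα2 : α ≤ Real.pi / 2 := by rw [hα]; gcongr
  have hs : 0 < Real.sin α := Real.sin_pos_of_pos_of_lt_pi hα0 (by linarith)
  obtain ⟨hβ1, hβ2⟩ := abs_le.1 hβ
  have h1 : (1 : ℂ) ∈ convexHull ℝ S := subset_convexHull ℝ S ⟨0, by omega, by simp⟩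
  have h2 : ω ∈ convexHull ℝ S := subset_convexHull ℝ S ⟨1, by omega, (pow_one ω).symm⟩
  have h0 : (0 : ℂ) ∈ convexHull ℝ S := by
    have hprim : IsPrimitiveRoot ω n := Complex.isPrimitiveRoot_exp n (by omega)
    have hsum := (convex_convexHull ℝ S).sum_mem (t := Finset.range n) (w := fun _ => (n : ℝ)⁻¹)
      (z := fun k => ω ^ k) (fun _ _ => by positivity)
      (by simp; field_simp) fun k hk => subset_convexHull ℝ S ⟨k, Finset.mem_range.1 hk, rfl⟩
    rwa [← Finset.smul_sum, hprim.geom_sum_eq_zero (by omega), smul_zero] at hsum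
  suffices H : ∃ a b : ℝ, 0 ≤ a ∧ 0 ≤ b ∧ a + b ≤ 1 ∧ r * Real.cos β = (a + b) * Real.cos α ∧
      r * Real.sin β = (a - b) * Real.sin α by
    obtain ⟨a, b, ha, hb, hab, hcos, hsin⟩ := H
    have hz : (r : ℂ) * Complex.exp ((β + α : ℝ) * Complex.I) = a • ω + b • (1 : ℂ) := by
      have hωα : ω = Complex.exp (α * Complex.I) * Complex.exp (α * Complex.I) := by
        rw [hω, ← Complex.exp_add, hα]; congr 1; push_cast; ring
      have hone : (1 : ℂ) = Complex.exp (α * Complex.I) * Complex.exp ((-α : ℝ) * Complex.I) := by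
        rw [← Complex.exp_add]; simp
      have hexp (x : ℝ) : Complex.exp (x * Complex.I) = Real.cos x + Real.sin x * Complex.I := by
        rw [Complex.exp_mul_I, Complex.ofReal_cos, Complex.ofReal_sin]
      have hsplit : Complex.exp ((β + α : ℝ) * Complex.I) =
          Complex.exp (α * Complex.I) * Complex.exp (β * Complex.I) := by
        rw [← Complex.exp_add]; push_cast; ring_nf
      have hcos' : (r : ℂ) * Real.cos β = (a + b) * Real.cos α := by exact_mod_cast hcos
      have hsin' : (r : ℂ) * Real.sin β = (a - b) * Real.sin α := by exact_mod_cast hsin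
      rw [hsplit, hωα, hone, Complex.real_smul, Complex.real_smul, hexp β, hexp (-α),
        Real.cos_neg, Real.sin_neg]
      nth_rewrite 3 [hexp α]
      push_cast at hcos' hsin' ⊢
      linear_combination Complex.exp (α * Complex.I) * hcos' +
        Complex.exp (α * Complex.I) * Complex.I * hsin'
    rw [hz]
    have := (convex_convexHull ℝ S).sum_mem (t := Finset.univ) (w := ![a, b, 1 - a - b])
      (z := ![ω, 1, 0]) (by simp [Fin.forall_fin_succ, ha, hb]; linarith)
      (by simp [Fin.sum_univ_succ]) (by simp [Fin.forall_fin_succ, h0, h1, h2])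
    simpa [Fin.sum_univ_succ] using this
  rcases hn.eq_or_lt with rfl | hn3
  · have hα' : α = Real.pi / 2 := by simp [hα]
    have hcβ : 0 ≤ Real.cos β :=
      Real.cos_nonneg_of_neg_pi_div_two_le_of_le (by linarith) (by linarith)
    rw [hα', Real.cos_pi_div_two] at h ⊢
    rw [Real.sin_pi_div_two]
    have hzero := le_antisymm h (mul_nonneg hr hcβ)
    have habs : |r * Real.sin β| ≤ 1 := by
      rw [abs_mul, abs_of_nonneg hr]
      exact mul_le_one₀ hr1 (abs_nonneg _) (Real.abs_sin_le_one β)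
    rcases le_total 0 (r * Real.sin β) with hy | hy
    · exact ⟨r * Real.sin β, 0, hy, le_rfl, by linarith [le_abs_self (r * Real.sin β)],
        by simpa using hzero, by simp⟩
    · exact ⟨0, -(r * Real.sin β), le_rfl, by linarith,
        by linarith [neg_abs_le (r * Real.sin β)], by simpa using hzero, by simp⟩
  · have hα3 : α < Real.pi / 2 := by
      rw [hα]
      exact div_lt_div_of_pos_left hπ two_pos (by exact_mod_cast hn3)
    have hc : 0 < Real.cos α := Real.cos_pos_of_mem_Ioo ⟨by linarith, hα3⟩
    have hden : 0 < 2 * (Real.sin α * Real.cos α) := by positivity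
    have hplus : 0 ≤ Real.sin (α + β) :=
      Real.sin_nonneg_of_nonneg_of_le_pi (by linarith) (by linarith)
    have hminus : 0 ≤ Real.sin (α - β) :=
      Real.sin_nonneg_of_nonneg_of_le_pi (by linarith) (by linarith)
    refine ⟨r * Real.sin (α + β) / (2 * (Real.sin α * Real.cos α)),
      r * Real.sin (α - β) / (2 * (Real.sin α * Real.cos α)), by positivity, by positivity,
      ?_, ?_, ?_⟩
    · rw [← add_div, div_le_one hden, Real.sin_add, Real.sin_sub]
      nlinarith [mul_le_mul_of_nonneg_left h hs.le]
    · rw [Real.sin_add, Real.sin_sub]; field_simp; ring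
    · rw [Real.sin_add, Real.sin_sub]; field_simp; ring

/-- Every Bargmann invariant of order `n`, pure or mixed, lies in `𝒫_n^n`. -/
theorem mixed_bargmann_mem_polygon_pow
    (n d : ℕ) (hn : 1 ≤ n) (hd : 1 ≤ d)
    (ρ : Fin n → Matrix (Fin d) (Fin d) ℂ)
    (hpsd : ∀ i, (ρ i).PosSemidef) (htr : ∀ i, (ρ i).trace = 1) :
    ∃ z ∈ convexHull ℝ
        {w : ℂ | ∃ k < n, w = Complex.exp (2 * Real.pi * Complex.I / n) ^ k},
      z ^ n = Matrix.trace (List.ofFn ρ).prod := by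
  have hπ := Real.pi_pos
  obtain ⟨m, rfl⟩ : ∃ m, n = m + 1 := ⟨n - 1, by omega⟩
  rcases Nat.eq_zero_or_pos m with rfl | hm
  · exact ⟨1, subset_convexHull ℝ _ ⟨0, by simp⟩, by simp [htr]⟩
  have hm' : (1 : ℝ) ≤ m := by exact_mod_cast hm
  set w := Matrix.trace (List.ofFn ρ).prod with hw
  obtain ⟨τ, hτ, hτ1, hτ2⟩ : ∃ τ : ℝ, ‖w‖ * Complex.exp (τ * Complex.I) = -w ∧
      -Real.pi ≤ τ ∧ τ ≤ Real.pi :=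
    ⟨(-w).arg, by simpa using Complex.norm_mul_exp_arg_mul_I (-w),
      (Complex.neg_pi_lt_arg _).le, Complex.arg_le_pi _⟩
  set β := τ / (m + 1) with hβ
  have hτβ : τ = (m + 1) * β := by rw [hβ]; field_simp
  have hβabs : |β| ≤ Real.pi / (m + 1 : ℕ) := by
    rw [hβ, abs_div, abs_of_pos (show (0 : ℝ) < m + 1 by linarith)]
    push_cast
    gcongr
    exact abs_le.2 ⟨hτ1, hτ2⟩
  have hpole : Real.pi / (m + 1) ≤ Real.pi / 2 := by gcongr; linarith
  push_cast at hβabs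
  obtain ⟨hβ1, hβ2⟩ := abs_le.1 hβabs
  have hcβ : 0 ≤ Real.cos β :=
    Real.cos_nonneg_of_neg_pi_div_two_le_of_le (by linarith) (by linarith)
  have hcα : 0 ≤ Real.cos (Real.pi / (m + 1)) :=
    Real.cos_nonneg_of_neg_pi_div_two_le_of_le
      (le_trans (by linarith) (show (0 : ℝ) ≤ Real.pi / (m + 1) by positivity)) hpole
  have hnorm : ‖w‖ ≤ 1 :=
    mem_closedBall_zero_iff.1 <| (convex_closedBall (0 : ℂ) 1).mixed_bargmann_mem
      (fun v hv => mem_closedBall_zero_iff.2 (norm_pure_bargmann_le_one v hv m)) hpsd htr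
  have hhalf : Convex ℝ {x : ℂ | (-x * Complex.exp (-(m * β * Complex.I))).re *
      Real.cos β ^ m ≤ Real.cos (Real.pi / (m + 1)) ^ (m + 1)} := by
    refine convex_halfSpace_le (f := fun x : ℂ => (-x * Complex.exp (-(m * β * Complex.I))).re *
      Real.cos β ^ m) ⟨fun x y => ?_, fun c x => ?_⟩ _
    · rw [neg_add, add_mul, Complex.add_re, add_mul]
    · rw [← smul_neg, smul_mul_assoc, Complex.smul_re, smul_mul_assoc]
  have hsupp : ‖w‖ * Real.cos β ^ (m + 1) ≤ Real.cos (Real.pi / (m + 1)) ^ (m + 1) := by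
    have := hhalf.mixed_bargmann_mem (fun v hv => re_pure_bargmann_le v hv hcβ hm) hpsd htr
    rw [Set.mem_ofPred_eq, ← hw, ← hτ, mul_assoc, ← Complex.exp_add] at this
    have he : (τ : ℂ) * Complex.I + -(m * β * Complex.I) = β * Complex.I := by
      rw [hτβ]; push_cast; ring
    rw [he, Complex.re_ofReal_mul, Complex.exp_ofReal_mul_I_re] at this
    rwa [pow_succ', ← mul_assoc]
  set r := ‖w‖ ^ ((m + 1 : ℕ) : ℝ)⁻¹ with hr
  have hr0 : 0 ≤ r := by positivity
  have hrpow : r ^ (m + 1) = ‖w‖ := Real.rpow_inv_natCast_pow (norm_nonneg w) (by omega)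
  refine ⟨r * Complex.exp ((β + Real.pi / (m + 1 : ℕ) : ℝ) * Complex.I),
    mem_polygon_of_re_le (by omega) hr0
      (Real.rpow_le_one (norm_nonneg w) hnorm (by positivity)) (by exact_mod_cast hβabs) ?_, ?_⟩
  · push_cast
    refine le_of_pow_le_pow_left₀ (Nat.succ_ne_zero m) hcα ?_
    rwa [mul_pow, hrpow]
  · rw [mul_pow, ← Complex.exp_nat_mul, ← Complex.ofReal_pow, hrpow]
    have he : ((m + 1 : ℕ) : ℂ) * ((β + Real.pi / (m + 1 : ℕ) : ℝ) * Complex.I) =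
        τ * Complex.I + Real.pi * Complex.I := by
      have : (m : ℂ) + 1 ≠ 0 := by exact_mod_cast Nat.succ_ne_zero m
      rw [hτβ]; push_cast; field_simp
    rw [he, Complex.exp_add, Complex.exp_pi_mul_I, mul_neg_one, mul_neg, hτ, neg_neg]
end
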